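/- Let A be a Hermitian n×n matrix, S a positivity-preserving self-adjoint linear map on C^{n×n}, and M the solution of the matrix Dyson equation -M(z)⁻¹ = z·I - A + S[M(z)] on ℍ with Stieltjes representation M(z) = ∫ (τ-z)⁻¹ V(dτ), V(ℝ) = I. Then spec A ⊂ supp V + [-‖S‖^{1/2}, ‖S‖^{1/2}], i.e., every eigenvalue of A is within distance ‖S‖^{1/2} of the support of V. -/

import Mathlib

open MeasureTheory

/-- Bounded operators on the Euclidean space `ℂⁿ` (identified with `n×n` complex matrices
with the operator norm). -/
abbrev Op (n : ℕ) := EuclideanSpace ℂ (Fin n) →L[ℂ] EuclideanSpace ℂ (Fin n)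

section PositiveOperators

variable {E : Type*} [NormedAddCommGroup E] [InnerProductSpace ℂ E]

/-- An arithmetic-mean form of the Cauchy-Schwarz inequality for a positive operator. -/
theorem ContinuousLinearMap.IsPositive.two_mul_norm_inner_le {T : E →L[ℂ] E}
    (hT : T.IsPositive) (x y : E) :
    2 * ‖inner ℂ x (T y)‖ ≤ (inner ℂ x (T x)).re + (inner ℂ y (T y)).re := by
  obtain ⟨c, hc, hcz⟩ := RCLike.exists_norm_eq_mul_self (inner ℂ x (T y))
  have hcc : (starRingEnd ℂ) c * c = 1 := by
    rw [← Complex.normSq_eq_conj_mul_self, Complex.normSq_eq_norm_sq, hc]; norm_num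
  have hpos : 0 ≤ (inner ℂ (x - c • y) (T (x - c • y))).re := hT.re_inner_nonneg_right _
  have hsymm : inner ℂ y (T x) = (starRingEnd ℂ) (inner ℂ x (T y)) := by
    rw [inner_conj_symm]
    exact (hT.isSymmetric y x).symm
  have hexpand : inner ℂ (x - c • y) (T (x - c • y))
      = inner ℂ x (T x) + inner ℂ y (T y) - c * inner ℂ x (T y)
        - (starRingEnd ℂ) (c * inner ℂ x (T y)) := by
    simp only [map_sub, map_smul, inner_sub_left, inner_sub_right, inner_smul_left,
      inner_smul_right, hsymm, map_mul]
    linear_combination (inner ℂ y (T y)) * hcc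
  have hcz' : c * inner ℂ x (T y) = ((‖inner ℂ x (T y)‖ : ℝ) : ℂ) := hcz.symm
  rw [hexpand, hcz', Complex.conj_ofReal] at hpos
  simp only [Complex.sub_re, Complex.add_re, Complex.ofReal_re] at hpos
  linarith

/-- Integrating a scalar function bounded by `C` against a normalized positive operator-valued
density gives an operator of norm at most `C`. -/
theorem norm_integral_smul_le_of_isPositive [CompleteSpace E] {α : Type*} [MeasurableSpace α]
    {μ : Measure α} {f : α → E →L[ℂ] E} (hf : ∀ a, (f a).IsPositive) (hint : Integrable f μ)
    (hTot : ∫ a, f a ∂μ = 1) {g : α → ℂ} {C : ℝ} (hC : 0 ≤ C) (hg : ∀ᵐ a ∂μ, ‖g a‖ ≤ C) :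
    ‖∫ a, g a • f a ∂μ‖ ≤ C := by
  by_cases hgf : Integrable (fun a => g a • f a) μ
  swap
  · rwa [integral_undef hgf, norm_zero]
  let φ : E → E → (E →L[ℂ] E) →L[ℂ] ℂ := fun x y =>
    (innerSL ℂ x).comp (ContinuousLinearMap.apply ℂ E y)
  have hφ : ∀ x y T, φ x y T = inner ℂ x (T y) := fun x y T => rfl
  have hre : ∀ x, Integrable (fun a => (inner ℂ x (f a x)).re) μ := fun x =>
    ((φ x x).integrable_comp hint).re
  have hreInt : ∀ x, ∫ a, (inner ℂ x (f a x)).re ∂μ = ‖x‖ ^ 2 := by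
    intro x
    have h1 : ∫ a, φ x x (f a) ∂μ = φ x x 1 := by
      rw [(φ x x).integral_comp_comm hint, hTot]
    have h2 := integral_re ((φ x x).integrable_comp hint)
    rw [h1, hφ] at h2
    exact h2.trans (inner_self_eq_norm_sq x)
  have key : ∀ x y, ‖inner ℂ x ((∫ a, g a • f a ∂μ) y)‖ ≤ C / 2 * (‖x‖ ^ 2 + ‖y‖ ^ 2) := by
    intro x y
    rw [← hφ, ← (φ x y).integral_comp_comm hgf, ← hreInt x, ← hreInt y,
      ← integral_add (hre x) (hre y), ← integral_const_mul]
    refine norm_integral_le_of_norm_le (((hre x).add (hre y)).const_mul _) ?_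
    filter_upwards [hg] with a ha
    rw [map_smul, norm_smul, hφ]
    have := (hf a).two_mul_norm_inner_le x y
    calc ‖g a‖ * ‖inner ℂ x (f a y)‖ ≤ C * ‖inner ℂ x (f a y)‖ := by gcongr
      _ ≤ _ := by nlinarith
  refine ContinuousLinearMap.opNorm_le_of_unit_norm hC fun y hy => ?_
  set z := (∫ a, g a • f a ∂μ) y with hz
  by_cases hz0 : z = 0
  · simpa [hz0]
  have hzn : ‖z‖ ≠ 0 := norm_ne_zero_iff.mpr hz0
  have h := key (((‖z‖⁻¹ : ℝ) : ℂ) • z) y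
  rw [← hz, inner_smul_left, inner_self_eq_norm_sq_to_K, norm_smul, hy] at h
  simp at h
  field_simp at h
  linarith

end PositiveOperators

theorem stmt_4 {n : ℕ} (A : Op n) (hA : IsSelfAdjoint A)
    (S : Op n →L[ℂ] Op n)
    (hSpos : ∀ T : Op n, T.IsPositive → (S T).IsPositive)
    (hSsa : ∀ R T : Op n,
      LinearMap.trace ℂ (EuclideanSpace ℂ (Fin n)) (ContinuousLinearMap.adjoint (S R) * T : Op n).toLinearMap
        = LinearMap.trace ℂ (EuclideanSpace ℂ (Fin n)) (ContinuousLinearMap.adjoint R * S T : Op n).toLinearMap)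
    (M : ℂ → Op n)
    (hDyson : ∀ w : ℂ, 0 < w.im → (w • (1 : Op n) - A + S (M w)) * M w = -1)
    (μ : Measure ℝ) [IsFiniteMeasure μ] (f : ℝ → Op n)
    (hf : ∀ τ : ℝ, (f τ).IsPositive)
    (hTot : ∫ τ, f τ ∂μ = 1)
    (hRep : ∀ w : ℂ, 0 < w.im → M w = ∫ τ, ((τ : ℂ) - w)⁻¹ • f τ ∂μ)
    (s : Set ℝ) (hsclosed : IsClosed s) (hμs : μ sᶜ = 0) :
    ∀ ζ ∈ spectrum ℂ A, Metric.infDist ζ (Complex.ofReal '' s) ≤ Real.sqrt ‖S‖ := by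
  intro ζ hζ
  have hζim : ζ.im = 0 := by
    rw [hA.mem_spectrum_eq_re hζ, Complex.ofReal_im]
  obtain ⟨v, hv0, hv⟩ : ∃ v : EuclideanSpace ℂ (Fin n), v ≠ 0 ∧ A v = ζ • v := by
    have h : ζ ∈ spectrum ℂ A.toLinearMap := by
      rwa [← ContinuousLinearMap.spectrum_eq]
    rw [← Module.End.hasEigenvalue_iff_mem_spectrum] at h
    obtain ⟨v, hv⟩ := h.exists_hasEigenvector
    exact ⟨v, hv.2, hv.apply_eq_smul⟩
  have hvn : 0 < ‖v‖ := norm_pos_iff.mpr hv0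
  have hint : Integrable f μ := by
    by_contra h
    rw [integral_undef h] at hTot
    apply hv0
    simpa using (congrArg (fun T : Op n => T v) hTot).symm
  set d := Metric.infDist ζ (Complex.ofReal '' s) with hd
  have hd_nonneg : 0 ≤ d := Metric.infDist_nonneg
  clear_value d
  rcases hd_nonneg.eq_or_lt with hd0 | hd0
  · rw [← hd0]; exact Real.sqrt_nonneg _
  refine Real.le_sqrt_of_sq_le ?_
  have hη : ∀ η : ℝ, 0 < η → d ^ 2 ≤ ‖S‖ + η := by
    intro η' hη'
    obtain ⟨η, hη, hηd⟩ : ∃ η, 0 < η ∧ η * d = η' := ⟨η' / d, by positivity, div_mul_cancel₀ _ hd0.ne'⟩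
    set w : ℂ := ζ + η * Complex.I with hw
    have hwim : 0 < w.im := by simpa [hw, hζim] using hη
    have hM : ‖M w‖ ≤ d⁻¹ := by
      rw [hRep w hwim]
      refine norm_integral_smul_le_of_isPositive hf hint hTot (by positivity) ?_
      have hs : ∀ᵐ τ ∂μ, τ ∈ s := hμs
      filter_upwards [hs] with τ hτ
      rw [norm_inv]
      refine inv_anti₀ hd0 ?_
      have h1 : d ≤ dist ζ (τ : ℂ) := hd ▸ Metric.infDist_le_dist_of_mem ⟨τ, hτ, rfl⟩
      refine h1.trans ?_
      rw [dist_comm, dist_eq_norm, Complex.norm_eq_sqrt_sq_add_sq, Complex.norm_eq_sqrt_sq_add_sq]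
      refine Real.sqrt_le_sqrt ?_
      simp [hw, hζim]
      positivity
    have hleft : M w * (w • (1 : Op n) - A + S (M w)) = -1 := by
      set D : Op n := w • (1 : Op n) - A + S (M w)
      have hneg : -D * M w = 1 := (neg_mul D (M w)).trans (by rw [hDyson w hwim, neg_neg])
      have hneg' : M w * -D = 1 := by
        apply ContinuousLinearMap.coe_injective
        exact mul_eq_one_comm (M := Module.End ℂ (EuclideanSpace ℂ (Fin n))).mp
          (congrArg ContinuousLinearMap.toLinearMap hneg)
      exact neg_eq_iff_eq_neg.mp ((mul_neg (M w) D).symm.trans hneg')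
    have hev : -v = M w ((η * Complex.I) • v + S (M w) v) := by
      have h := congrArg (fun T : Op n => T v) hleft
      simp only [mul_apply_eq_comp, add_apply,
        sub_apply, smul_apply,
        one_apply_eq_self, neg_apply, hv] at h
      rw [← h, hw, add_smul, add_sub_cancel_left]
    have hbound : ‖v‖ ≤ d⁻¹ * (η * ‖v‖ + ‖S‖ * d⁻¹ * ‖v‖) := by
      calc ‖v‖ = ‖M w ((η * Complex.I) • v + S (M w) v)‖ := by rw [← hev, norm_neg]
        _ ≤ ‖M w‖ * ‖(η * Complex.I) • v + S (M w) v‖ := (M w).le_opNorm _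
        _ ≤ d⁻¹ * (η * ‖v‖ + ‖S‖ * d⁻¹ * ‖v‖) := by
          gcongr
          refine (norm_add_le _ _).trans (add_le_add ?_ ?_)
          · rw [norm_smul]; simp [abs_of_pos hη]
          · exact (S (M w)).le_of_opNorm_le (S.le_of_opNorm_le_of_le le_rfl hM) v
    rw [← hηd]
    have h2 : 1 * ‖v‖ ≤ (d⁻¹ * (η + ‖S‖ * d⁻¹)) * ‖v‖ := by linarith
    have h3 := le_of_mul_le_mul_right h2 hvn
    have h4 : d ^ 2 * 1 ≤ d ^ 2 * (d⁻¹ * (η + ‖S‖ * d⁻¹)) := by gcongr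
    have h5 : d ^ 2 * (d⁻¹ * (η + ‖S‖ * d⁻¹)) = ‖S‖ + η * d := by
      have := hd0.ne'
      field_simp
      ring
    linarith
  exact le_of_forall_pos_le_add hη
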